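/- arXiv:2312.05997 — 2 statements merged into one kernel-verified Lean document; each statement's English description precedes it below -/
import Mathlib

section
/- Let (E₁,…,Eₙ) be a complete exceptional sequence over a hereditary algebra Λ. Then Eₖ is relatively projective if and only if Ext¹(Eₖ, X) = 0 for all X ∈ 𝒜ₖ ∩ E_{k−1}^⊥, where 𝒜ₖ = (E_{k+1}⊕⋯⊕Eₙ)^⊥. -/
open CategoryTheory

universe u

variable {A : Type u} [Ring A]

namespace ExcSeq

/-- `Hom(X, Y) = 0`. -/
def homZero (X Y : ModuleCat.{u} A) : Prop := ∀ f : X ⟶ Y, f = 0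

/-- `Ext¹(X, Y) = 0`: every short exact sequence `0 → Y → E → X → 0` splits. -/
def extZero (X Y : ModuleCat.{u} A) : Prop :=
  ∀ (E : ModuleCat.{u} A) (i : Y ⟶ E) (p : E ⟶ X) (w : i ≫ p = 0),
    (ShortComplex.mk i p w).ShortExact → ∃ s : X ⟶ E, s ≫ p = 𝟙 X

/-- `Y` belongs to the right perpendicular category `X^⊥`. -/
def rperp (X Y : ModuleCat.{u} A) : Prop := homZero X Y ∧ extZero X Y

/-- `Y` belongs to the left perpendicular category `^⊥X`. -/
def lperp (X Y : ModuleCat.{u} A) : Prop := homZero Y X ∧ extZero Y X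

/-- An exceptional module: finitely generated, rigid, with division algebra endomorphism
ring (in particular nonzero and indecomposable). -/
def ExceptionalMod (X : ModuleCat.{u} A) : Prop :=
  Module.Finite A X ∧ extZero X X ∧ Nontrivial X ∧ ∀ f : X ⟶ X, f ≠ 0 → IsIso f

/-- An exceptional sequence `(E 0, …, E (n-1))`. -/
def IsExcSeq {n : ℕ} (E : Fin n → ModuleCat.{u} A) : Prop :=
  (∀ i, ExceptionalMod (E i)) ∧ ∀ i j : Fin n, i < j → rperp (E j) (E i)

/-- A complete exceptional sequence: an exceptional sequence of maximal length. -/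
def CompleteES {n : ℕ} (E : Fin n → ModuleCat.{u} A) : Prop :=
  IsExcSeq E ∧ ∀ (m : ℕ) (F : Fin m → ModuleCat.{u} A), IsExcSeq F → m ≤ n

/-- The wide subcategory `𝒜ₖ = (E_{k+1} ⊕ ⋯ ⊕ Eₙ)^⊥`. -/
def Aperp {n : ℕ} (E : Fin n → ModuleCat.{u} A) (k : Fin n) (X : ModuleCat.{u} A) : Prop :=
  ∀ j : Fin n, k < j → rperp (E j) X

/-- The wide subcategory `ℬₖ = ^⊥(E₁ ⊕ ⋯ ⊕ E_{k-1})`. -/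
def Bperp {n : ℕ} (E : Fin n → ModuleCat.{u} A) (k : Fin n) (X : ModuleCat.{u} A) : Prop :=
  ∀ j : Fin n, j < k → lperp (E j) X

/-- `X` is a projective object of the subcategory (given by the predicate) `C`. -/
def ProjIn (C : ModuleCat.{u} A → Prop) (X : ModuleCat.{u} A) : Prop :=
  C X ∧ ∀ (Y Z : ModuleCat.{u} A), C Y → C Z → ∀ p : Y ⟶ Z, Epi p →
    ∀ f : X ⟶ Z, ∃ g : X ⟶ Y, g ≫ p = f

/-- `X` is an injective object of the subcategory (given by the predicate) `C`. -/
def InjIn (C : ModuleCat.{u} A → Prop) (X : ModuleCat.{u} A) : Prop :=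
  C X ∧ ∀ (Y Z : ModuleCat.{u} A), C Y → C Z → ∀ i : Y ⟶ Z, Mono i →
    ∀ f : Y ⟶ X, ∃ g : Z ⟶ X, i ≫ g = f

/-- `E k` is relatively projective in the exceptional sequence `E`. -/
def RelProj {n : ℕ} (E : Fin n → ModuleCat.{u} A) (k : Fin n) : Prop :=
  ProjIn (Aperp E k) (E k)

/-- `E k` is relatively injective in the exceptional sequence `E`. -/
def RelInj {n : ℕ} (E : Fin n → ModuleCat.{u} A) (k : Fin n) : Prop :=
  InjIn (Bperp E k) (E k)

/-- `Λ` is hereditary: every submodule of a projective module is projective. -/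
def Hereditary (A : Type u) [Ring A] : Prop :=
  ∀ (P : ModuleCat.{u} A), Projective P →
    ∀ S : Submodule A P, Projective (ModuleCat.of A S)

/-- The simple module `S` is in the support of `M`, i.e. `S` is (isomorphic to) a
composition factor (subquotient) of `M`. -/
def InSupport (S M : ModuleCat.{u} A) : Prop :=
  ∃ (N₁ N₂ : Submodule A M), N₁ ≤ N₂ ∧
    Nonempty ((ModuleCat.of A (N₂ ⧸ (Submodule.comap N₂.subtype N₁))) ≅ S)


section helpers

variable {R : Type u} [Ring R]
variable {P X Y Y' Y'' : Type u} [AddCommGroup P] [Module R P] [AddCommGroup X] [Module R X]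
  [AddCommGroup Y] [Module R Y] [AddCommGroup Y'] [Module R Y'] [AddCommGroup Y''] [Module R Y'']

/-- Concrete vanishing of Ext via a presentation. -/
def EZ (π : P →ₗ[R] X) (Y : Type u) [AddCommGroup Y] [Module R Y] : Prop :=
  ∀ f : LinearMap.ker π →ₗ[R] Y, ∃ g : P →ₗ[R] Y, ∀ k : LinearMap.ker π, g k = f k

lemma descend (π : P →ₗ[R] X) (hπ : Function.Surjective π) (g : P →ₗ[R] Y)
    (h : ∀ x, π x = 0 → g x = 0) : ∃ s : X →ₗ[R] Y, ∀ x, s (π x) = g x := by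
  let e := π.quotKerEquivOfSurjective hπ
  refine ⟨((LinearMap.ker π).liftQ g (fun x hx => h x hx)) ∘ₗ e.symm.toLinearMap, fun x => ?_⟩
  have : e.symm (π x) = (LinearMap.ker π).mkQ x := by
    rw [LinearEquiv.symm_apply_eq]; rfl
  rw [LinearMap.comp_apply, LinearEquiv.coe_coe, this]
  exact Submodule.liftQ_apply _ _ _

lemma factor (i : Y' →ₗ[R] Y) (hi : Function.Injective i) (f : X →ₗ[R] Y)
    (h : ∀ x, ∃ y, i y = f x) : ∃ g : X →ₗ[R] Y', ∀ x, i (g x) = f x := by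
  let e := LinearEquiv.ofInjective i hi
  refine ⟨e.symm.toLinearMap ∘ₗ f.codRestrict (LinearMap.range i) h, fun x => ?_⟩
  have := congrArg Subtype.val (e.apply_symm_apply (f.codRestrict (LinearMap.range i) h x))
  exact this

lemma lift (hP : Module.Projective R P) (q : Y →ₗ[R] Y'') (hq : Function.Surjective q)
    (f : P →ₗ[R] Y'') : ∃ g : P →ₗ[R] Y, ∀ x, q (g x) = f x := by
  obtain ⟨g, hg⟩ := Module.projective_lifting_property q f hq
  exact ⟨g, fun x => by rw [← hg]; rfl⟩

lemma EZ.quot {π : P →ₗ[R] X} (hK : Module.Projective R (LinearMap.ker π))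
    (q : Y →ₗ[R] Y'') (hq : Function.Surjective q) (h : EZ π Y) : EZ π Y'' := by
  intro f
  obtain ⟨f', hf'⟩ := lift hK q hq f
  obtain ⟨g, hg⟩ := h f'
  exact ⟨q ∘ₗ g, fun k => by simp [hg, hf']⟩

lemma EZ.ext {π : P →ₗ[R] X} (hP : Module.Projective R P)
    (i : Y' →ₗ[R] Y) (hi : Function.Injective i) (q : Y →ₗ[R] Y'') (hq : Function.Surjective q)
    (hex : Function.Exact i q) (h' : EZ π Y') (h'' : EZ π Y'') : EZ π Y := by
  intro f
  obtain ⟨h, hh⟩ := h'' (q ∘ₗ f)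
  obtain ⟨g, hg⟩ := lift hP q hq h
  obtain ⟨d, hd⟩ := factor i hi (f - g ∘ₗ (LinearMap.ker π).subtype) (fun x => by
    apply (hex _).1
    simp [hg, hh])
  obtain ⟨e, he⟩ := h' d
  refine ⟨g + i ∘ₗ e, fun k => ?_⟩
  simp [he, hd]

lemma EZ.sub {π : P →ₗ[R] X} (hπ : Function.Surjective π)
    (i : Y' →ₗ[R] Y) (hi : Function.Injective i) (q : Y →ₗ[R] Y'')
    (hex : Function.Exact i q) (h : EZ π Y) (h'' : ∀ f : X →ₗ[R] Y'', f = 0) : EZ π Y' := by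
  intro f
  obtain ⟨g, hg⟩ := h (i ∘ₗ f)
  obtain ⟨s, hs⟩ := descend π hπ (q ∘ₗ g) (fun x hx => by
    have := hg ⟨x, hx⟩
    simp only [LinearMap.comp_apply] at this ⊢
    rw [this]; exact hex.apply_apply_eq_zero _)
  rw [h'' s] at hs
  obtain ⟨d, hd⟩ := factor i hi g (fun x => (hex _).1 (by simpa using (hs x).symm))
  refine ⟨d, fun k => hi ?_⟩
  rw [hd, hg]; rfl

lemma EZ.homlift {π : P →ₗ[R] X} (hP : Module.Projective R P) (hπ : Function.Surjective π)
    (i : Y' →ₗ[R] Y) (hi : Function.Injective i) (q : Y →ₗ[R] Y'') (hq : Function.Surjective q)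
    (hex : Function.Exact i q) (h : EZ π Y') (f : X →ₗ[R] Y'') :
    ∃ g : X →ₗ[R] Y, ∀ x, q (g x) = f x := by
  obtain ⟨g, hg⟩ := lift hP q hq (f ∘ₗ π)
  obtain ⟨d, hd⟩ := factor i hi (g ∘ₗ (LinearMap.ker π).subtype) (fun x => by
    apply (hex _).1
    have := x.2
    simp [hg])
  obtain ⟨e, he⟩ := h d
  obtain ⟨s, hs⟩ := descend π hπ (g - i ∘ₗ e) (fun x hx => by
    have h1 := he ⟨x, hx⟩
    have h2 := hd ⟨x, hx⟩
    simp only [LinearMap.sub_apply, LinearMap.comp_apply, Submodule.subtype_apply] at *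
    rw [h1, h2, sub_self])
  refine ⟨s, fun x => ?_⟩
  obtain ⟨y, rfl⟩ := hπ x
  rw [hs]
  simp [hg, hex.apply_apply_eq_zero]

lemma hom_ext_zero (i : Y' →ₗ[R] Y) (q : Y →ₗ[R] Y'')
    (hex : Function.Exact i q) (hi : Function.Injective i)
    (h' : ∀ f : X →ₗ[R] Y', f = 0) (h'' : ∀ f : X →ₗ[R] Y'', f = 0)
    (f : X →ₗ[R] Y) : f = 0 := by
  obtain ⟨d, hd⟩ := factor i hi f (fun x => (hex _).1 (by
    simpa using LinearMap.congr_fun (h'' (q ∘ₗ f)) x))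
  ext x
  rw [← hd, h' d]; simp

lemma hom_sum_zero (I : Type u) (h : ∀ f : X →ₗ[R] Y, f = 0) (f : X →ₗ[R] (I →₀ Y)) : f = 0 := by
  ext x a
  simpa using LinearMap.congr_fun (h (Finsupp.lapply a ∘ₗ f)) x

lemma EZ.sum {π : P →ₗ[R] X} (hK : Module.Finite R (LinearMap.ker π)) (I : Type u)
    (h : EZ π Y) : EZ π (I →₀ Y) := by
  classical
  intro f
  obtain ⟨S, hS⟩ := hK.fg_top
  choose g hg using fun a : I => h (Finsupp.lapply a ∘ₗ f)
  let T : Finset I := S.biUnion (fun k => (f k).support)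
  refine ⟨∑ a ∈ T, Finsupp.lsingle a ∘ₗ g a, fun k => ?_⟩
  have key : (∑ a ∈ T, Finsupp.lsingle a ∘ₗ Finsupp.lapply a ∘ₗ f) = f := by
    apply LinearMap.ext_on (s := (S : Set _)) (by rw [hS])
    intro x hx
    simp only [LinearMap.sum_apply, LinearMap.comp_apply, Finsupp.lsingle_apply,
      Finsupp.lapply_apply]
    have hsub : (f x).support ⊆ T := Finset.subset_biUnion_of_mem (fun k => (f k).support) hx
    have := Finsupp.sum_of_support_subset (f x) hsub (fun a b => Finsupp.single a b) (by simp)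
    rw [← this]
    exact Finsupp.sum_single _
  conv_rhs => rw [← key]
  simp only [LinearMap.sum_apply, LinearMap.comp_apply]
  refine Finset.sum_congr rfl fun a _ => ?_
  rw [hg]; rfl

/-- universal extension -/
lemma universal {π : P →ₗ[R] X} (hP : Module.Projective R P) (hπ : Function.Surjective π)
    (hK : Module.Finite R (LinearMap.ker π)) (h : EZ π X) (Y : Type u) [AddCommGroup Y]
    [Module R Y] : ∃ (I : Type u) (Z : Type u) (_ : AddCommGroup Z) (_ : Module R Z)
      (i : Y →ₗ[R] Z) (q : Z →ₗ[R] (I →₀ X)), Function.Injective i ∧ Function.Surjective q ∧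
      Function.Exact i q ∧ EZ π Z := by
  classical
  let I := LinearMap.ker π →ₗ[R] Y
  let F : (I →₀ LinearMap.ker π) →ₗ[R] Y := Finsupp.lsum ℕ (fun f : I => f)
  let G : (I →₀ LinearMap.ker π) →ₗ[R] (I →₀ P) :=
    Finsupp.mapRange.linearMap (LinearMap.ker π).subtype
  let Q : (I →₀ P) →ₗ[R] (I →₀ X) := Finsupp.mapRange.linearMap π
  have hG : Function.Injective G :=
    Finsupp.mapRange_injective _ (by simp) (Submodule.injective_subtype _)
  have hQ : Function.Surjective Q := Finsupp.mapRange_surjective _ (by simp) hπ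
  have hQG : ∀ k, Q (G k) = 0 := by
    intro k; ext a
    simp [Q, G]
  have hGQ : ∀ x, Q x = 0 → ∃ k, G k = x := by
    intro x hx
    have hx' : ∀ a, π (x a) = 0 := fun a => by
      have := DFunLike.congr_fun hx a
      simpa [Q] using this
    refine ⟨Finsupp.onFinset x.support (fun a => ⟨x a, hx' a⟩) ?_, ?_⟩
    · intro a ha
      rw [Finsupp.mem_support_iff]
      intro h0; apply ha; ext; exact h0
    · ext a; simp [G]
  let N : Submodule R (Y × (I →₀ P)) := LinearMap.range (F.prod (-G))
  let i : Y →ₗ[R] ((Y × (I →₀ P)) ⧸ N) := N.mkQ ∘ₗ LinearMap.inl R Y (I →₀ P)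
  let q : ((Y × (I →₀ P)) ⧸ N) →ₗ[R] (I →₀ X) := N.liftQ (Q ∘ₗ LinearMap.snd R Y (I →₀ P)) (by
    rintro _ ⟨k, rfl⟩
    simp [hQG])
  have hi : Function.Injective i := by
    rw [injective_iff_map_eq_zero]
    intro y hy
    have : (y, (0 : I →₀ P)) ∈ N := by
      simpa [i, Submodule.Quotient.mk_eq_zero] using hy
    obtain ⟨k, hk⟩ := this
    have h1 := congrArg Prod.fst hk
    have h2 := congrArg Prod.snd hk
    simp only [LinearMap.prod_apply, Function.prod_apply, LinearMap.neg_apply, neg_eq_zero] at h1 h2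
    have : k = 0 := hG (by rw [h2, map_zero])
    rw [← h1, this, map_zero]
  have hq : Function.Surjective q := by
    intro z
    obtain ⟨x, rfl⟩ := hQ z
    exact ⟨N.mkQ (0, x), by simp [q]⟩
  have hex : Function.Exact i q := by
    intro z
    constructor
    · intro hz
      obtain ⟨⟨y, x⟩, rfl⟩ := N.mkQ_surjective z
      have hx : Q x = 0 := by simpa [q] using hz
      obtain ⟨k, rfl⟩ := hGQ x hx
      refine ⟨y + F k, ?_⟩
      change N.mkQ _ = N.mkQ _
      rw [← sub_eq_zero, ← map_sub, ← LinearMap.mem_ker, Submodule.ker_mkQ]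
      exact ⟨k, by simp⟩
    · rintro ⟨y, rfl⟩
      simp [i, q]
  refine ⟨I, _, inferInstance, inferInstance, i, q, hi, hq, hex, ?_⟩
  intro f
  obtain ⟨h1, hh1⟩ := h.sum hK I (q ∘ₗ f)
  obtain ⟨g, hg⟩ := lift hP q hq h1
  obtain ⟨d, hd⟩ := factor i hi (f - g ∘ₗ (LinearMap.ker π).subtype) (fun x => by
    apply (hex _).1
    simp [hg, hh1])
  refine ⟨g + N.mkQ ∘ₗ LinearMap.inr R Y (I →₀ P) ∘ₗ Finsupp.lsingle d, fun k => ?_⟩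
  have h3 : N.mkQ (0, Finsupp.single d (k : P)) = i (d k) := by
    change N.mkQ _ = N.mkQ _
    rw [eq_comm, ← sub_eq_zero, ← map_sub, ← LinearMap.mem_ker, Submodule.ker_mkQ]
    refine ⟨Finsupp.single d k, ?_⟩
    simp [F, G]
  have h4 := hd k
  rw [← h3] at h4
  simp only [LinearMap.sub_apply, LinearMap.comp_apply, Submodule.subtype_apply] at h4
  simp only [LinearMap.add_apply, LinearMap.comp_apply, LinearMap.inr_apply, Finsupp.lsingle_apply]
  rw [h4]; abel

lemma extZero_iff {X Y : ModuleCat.{u} R} (π : P →ₗ[R] X) (hP : Module.Projective R P)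
    (hπ : Function.Surjective π) : extZero X Y ↔ EZ π Y := by
  constructor
  · intro h f
    let N : Submodule R (Y × P) := LinearMap.range (f.prod (-(LinearMap.ker π).subtype))
    let i : Y →ₗ[R] ((Y × P) ⧸ N) := N.mkQ ∘ₗ LinearMap.inl R Y P
    let q : ((Y × P) ⧸ N) →ₗ[R] X := N.liftQ (π ∘ₗ LinearMap.snd R Y P) (by
      rintro _ ⟨k, rfl⟩
      simp)
    have hi : Function.Injective i := by
      rw [injective_iff_map_eq_zero]
      intro y hy
      have : (y, (0 : P)) ∈ N := by
        simpa [i, Submodule.Quotient.mk_eq_zero] using hy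
      obtain ⟨k, hk⟩ := this
      have h1 := congrArg Prod.fst hk
      have h2 := congrArg Prod.snd hk
      simp only [LinearMap.prod_apply, Function.prod_apply, LinearMap.neg_apply, neg_eq_zero] at h1 h2
      have : k = 0 := Subtype.ext h2
      rw [← h1, this, map_zero]
    have hq : Function.Surjective q := by
      intro z
      obtain ⟨x, rfl⟩ := hπ z
      exact ⟨N.mkQ (0, x), by simp [q]⟩
    have hex : Function.Exact i q := by
      intro z
      constructor
      · intro hz
        obtain ⟨⟨y, x⟩, rfl⟩ := N.mkQ_surjective z
        have hx : π x = 0 := by simpa [q] using hz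
        refine ⟨y + f ⟨x, hx⟩, ?_⟩
        change N.mkQ _ = N.mkQ _
        rw [← sub_eq_zero, ← map_sub, ← LinearMap.mem_ker, Submodule.ker_mkQ]
        exact ⟨⟨x, hx⟩, by simp⟩
      · rintro ⟨y, rfl⟩
        simp [i, q]
    obtain ⟨s, hs⟩ := h (ModuleCat.of R ((Y × P) ⧸ N)) (ModuleCat.ofHom i) (ModuleCat.ofHom q)
      (by ext y; exact hex.apply_apply_eq_zero y)
      { exact := (ShortComplex.ShortExact.moduleCat_exact_iff_function_exact _).2 hex
        mono_f := (ModuleCat.mono_iff_injective _).2 hi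
        epi_g := (ModuleCat.epi_iff_surjective _).2 hq }
    have hs' : ∀ x, q (s.hom x) = x := fun x => by
      have := congrArg (fun t => t.hom x) hs
      simpa using this
    obtain ⟨d, hd⟩ := factor i hi (N.mkQ ∘ₗ LinearMap.inr R Y P - s.hom ∘ₗ π) (fun x => by
      apply (hex _).1
      rw [LinearMap.sub_apply, map_sub, LinearMap.comp_apply s.hom, hs']
      simp [q])
    refine ⟨d, fun k => hi ?_⟩
    rw [hd]
    have hk : π k = 0 := k.2
    simp only [LinearMap.sub_apply, LinearMap.comp_apply, hk, map_zero, sub_zero]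
    change N.mkQ _ = N.mkQ _
    rw [eq_comm, ← sub_eq_zero, ← map_sub, ← LinearMap.mem_ker, Submodule.ker_mkQ]
    exact ⟨k, by simp⟩
  · intro h E i p w hse
    have hi : Function.Injective i.hom := (ModuleCat.mono_iff_injective _).1 hse.mono_f
    have hp : Function.Surjective p.hom := (ModuleCat.epi_iff_surjective _).1 hse.epi_g
    have hex : Function.Exact i.hom p.hom :=
      (ShortComplex.ShortExact.moduleCat_exact_iff_function_exact _).1 hse.exact
    obtain ⟨g, hg⟩ := h.homlift hP hπ i.hom hi p.hom hp hex LinearMap.id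
    exact ⟨ModuleCat.ofHom g, by ext x; exact hg x⟩

lemma homZero_iff {X Y : ModuleCat.{u} R} : homZero X Y ↔ ∀ f : X →ₗ[R] Y, f = 0 := by
  constructor
  · intro h f
    have := congrArg ModuleCat.Hom.hom (h (ModuleCat.ofHom f))
    simpa using this
  · intro h f
    ext x; simp [h f.hom]

lemma exists_pres [IsNoetherianRing R] (hR : Hereditary R) (X : ModuleCat.{u} R)
    (hX : Module.Finite R X) : ∃ (P : Type u) (_ : AddCommGroup P) (_ : Module R P)
      (π : P →ₗ[R] X), Module.Projective R P ∧ Function.Surjective π ∧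
      Module.Projective R (LinearMap.ker π) ∧ Module.Finite R (LinearMap.ker π) := by
  obtain ⟨m, π, hπ⟩ := Module.Finite.exists_fin' R X
  refine ⟨Fin m → R, inferInstance, inferInstance, π, inferInstance, hπ, ?_, inferInstance⟩
  have := hR (ModuleCat.of R (Fin m → R))
    ((IsProjective.iff_projective _).1 (inferInstanceAs (Module.Projective R (Fin m → R))))
    (LinearMap.ker π)
  exact (IsProjective.iff_projective (R := R) (LinearMap.ker π)).2 this

end helpers

/-- `Eₖ` is relatively projective if and only if `Ext¹(Eₖ, X) = 0` for
every `X ∈ 𝒜ₖ ∩ E_{k-1}^⊥` (here `j` is the index `k - 1`). -/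
theorem stmt6 {K : Type u} [Field K] {A : Type u} [Ring A] [Algebra K A]
    [FiniteDimensional K A] (hA : Hereditary A)
    {n : ℕ} (E : Fin n → ModuleCat.{u} A) (hE : CompleteES E)
    (j k : Fin n) (hjk : (j : ℕ) + 1 = k) :
    RelProj E k ↔
      ∀ X : ModuleCat.{u} A, Aperp E k X → rperp (E j) X → extZero (E k) X := by
  haveI : IsNoetherianRing A := isNoetherian_of_tower K (inferInstanceAs (IsNoetherian K A))
  choose P iP1 iP2 π hP hπ hKp hKf using fun a => exists_pres hA (E a) (hE.1.1 a).1
  have ez : ∀ a (Y : ModuleCat.{u} A), extZero (E a) Y ↔ EZ (π a) Y :=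
    fun a Y => extZero_iff (π a) (hP a) (hπ a)
  have hlt : j < k := by rw [Fin.lt_def]; omega
  have hkk : Aperp E k (E k) := fun l hl => hE.1.2 k l hl
  constructor
  · rintro ⟨_, hproj⟩ X hX _ Z i p w hse
    have hi : Function.Injective i.hom := (ModuleCat.mono_iff_injective _).1 hse.mono_f
    have hp : Function.Surjective p.hom := (ModuleCat.epi_iff_surjective _).1 hse.epi_g
    have hex : Function.Exact i.hom p.hom :=
      (ShortComplex.ShortExact.moduleCat_exact_iff_function_exact _).1 hse.exact
    refine hproj Z (E k) (fun l hl => ⟨?_, ?_⟩) hkk p hse.epi_g (𝟙 _)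
    · exact homZero_iff.2 (hom_ext_zero i.hom p.hom hex hi
        (homZero_iff.1 (hX l hl).1) (homZero_iff.1 (hkk l hl).1))
    · exact (ez l Z).2 (EZ.ext (hP l) i.hom hi p.hom hp hex
        ((ez l X).1 (hX l hl).2) ((ez l _).1 (hkk l hl).2))
  · intro H
    -- Ext vanishes on all of the perpendicular category
    have main : ∀ Y : ModuleCat.{u} A, Aperp E k Y → EZ (π k) Y := by
      intro Y hY
      have hMM : EZ (π j) (E j) := (ez j _).1 (hE.1.1 j).2.1
      obtain ⟨I, Z, iZ1, iZ2, i, q, hi, hq, hex, hMZ⟩ :=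
        universal (hP j) (hπ j) (hKf j) hMM Y
      have hNM : rperp (E k) (E j) := hE.1.2 j k hlt
      refine EZ.sub (hπ k) i hi q hex ?_ (hom_sum_zero I (homZero_iff.1 hNM.1))
      -- the evaluation map
      let ev : ((E j →ₗ[A] Z) →₀ E j) →ₗ[A] Z := Finsupp.lsum ℕ (fun f => f)
      let T : Submodule A Z := LinearMap.range ev
      have hT : ∀ a, EZ (π a) (E j) → EZ (π a) T := fun a ha =>
        EZ.quot (hKp a) ev.rangeRestrict ev.surjective_rangeRestrict (ha.sum (hKf a) _)
      have hTi : Function.Injective T.subtype := T.injective_subtype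
      have hTq : Function.Surjective T.mkQ := T.mkQ_surjective
      have hTex : Function.Exact T.subtype T.mkQ := LinearMap.exact_subtype_mkQ T
      have hLM : ∀ l, k < l → rperp (E l) (E j) := fun l hl => hE.1.2 j l (hlt.trans hl)
      have hLZ : ∀ l, k < l → EZ (π l) Z := fun l hl =>
        EZ.ext (hP l) i hi q hq hex ((ez l Y).1 (hY l hl).2)
          (((ez l _).1 (hLM l hl).2).sum (hKf l) I)
      have hLZ0 : ∀ l, k < l → ∀ f : E l →ₗ[A] Z, f = 0 := fun l hl =>
        hom_ext_zero i q hex hi (homZero_iff.1 (hY l hl).1)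
          (hom_sum_zero I (homZero_iff.1 (hLM l hl).1))
      refine EZ.ext (hP k) T.subtype hTi T.mkQ hTq hTex (hT k ((ez k _).1 hNM.2)) ?_
      refine (ez k (ModuleCat.of A (Z ⧸ T))).1 (H _ (fun l hl => ⟨?_, ?_⟩) ⟨?_, ?_⟩)
      · refine homZero_iff.2 fun f => ?_
        obtain ⟨g, hg⟩ := EZ.homlift (hP l) (hπ l) T.subtype hTi T.mkQ hTq hTex
          (hT l ((ez l _).1 (hLM l hl).2)) f
        ext x
        rw [← hg, hLZ0 l hl g]; simp
      · exact (ez l _).2 (EZ.quot (hKp l) T.mkQ hTq (hLZ l hl))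
      · refine homZero_iff.2 fun f => ?_
        obtain ⟨g, hg⟩ := EZ.homlift (hP j) (hπ j) T.subtype hTi T.mkQ hTq hTex (hT j hMM) f
        ext x
        rw [← hg]
        have : g x ∈ T := ⟨Finsupp.single g x, by simp [ev]⟩
        simpa using this
      · exact (ez j _).2 (EZ.quot (hKp j) T.mkQ hTq hMZ)
    refine ⟨hkk, fun Y Z hY hZ p hp f => ?_⟩
    have hp' : Function.Surjective p.hom := (ModuleCat.epi_iff_surjective _).1 hp
    let S := LinearMap.ker p.hom
    have hSi : Function.Injective S.subtype := S.injective_subtype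
    have hSex : Function.Exact S.subtype p.hom := LinearMap.exact_subtype_ker_map p.hom
    have hS : EZ (π k) S := main (ModuleCat.of A S) (fun l hl => ⟨?_, ?_⟩)
    · obtain ⟨g, hg⟩ := EZ.homlift (hP k) (hπ k) S.subtype hSi p.hom hp' hSex hS f.hom
      exact ⟨ModuleCat.ofHom g, by ext x; exact hg x⟩
    · refine homZero_iff.2 fun g => ?_
      have h0 := homZero_iff.1 (hY l hl).1 (S.subtype ∘ₗ g)
      ext x
      simpa using LinearMap.congr_fun h0 x
    · exact (ez l _).2 (EZ.sub (hπ l) S.subtype hSi p.hom hSex ((ez l Y).1 (hY l hl).2)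
        (homZero_iff.1 (hZ l hl).1))

end ExcSeq
end

section
/- Let (E₁,…,Eₙ) be a complete exceptional sequence over a hereditary algebra Λ such that Eₖ is relatively injective. If Eₖ is not relatively projective, then the support of Eₖ is contained in the union of the supports of E₁,…,E_{k−1}. -/
open CategoryTheory

universe u

variable {A : Type u} [Ring A]

namespace ExcSeq

section helpers

open Abelian Limits

/-- `Ext¹ = 0` via Mathlib's `Ext`. -/
def e0 (X Y : ModuleCat.{u} A) : Prop := ∀ e : Ext.{u} X Y 1, e = 0

lemma lift_of_e0 {S : ShortComplex (ModuleCat.{u} A)} (hS : S.ShortExact) {X : ModuleCat.{u} A}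
    (h : e0 X S.X₁) (f : X ⟶ S.X₃) : ∃ g : X ⟶ S.X₂, g ≫ S.g = f := by
  obtain ⟨x, hx⟩ := Ext.covariant_sequence_exact₃ X hS (Ext.mk₀ f) (zero_add 1) (h _)
  obtain ⟨g, rfl⟩ := (Ext.mk₀_bijective _ _).2 x
  rw [Ext.mk₀_comp_mk₀] at hx
  exact ⟨g, (Ext.mk₀_bijective _ _).1 hx⟩

lemma extend_of_e0 {S : ShortComplex (ModuleCat.{u} A)} (hS : S.ShortExact) {Y : ModuleCat.{u} A}
    (h : e0 S.X₃ Y) (f : S.X₁ ⟶ Y) : ∃ g : S.X₂ ⟶ Y, S.f ≫ g = f := by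
  obtain ⟨x, hx⟩ := Ext.contravariant_sequence_exact₁ hS Y (Ext.mk₀ f) (add_zero 1) (h _)
  obtain ⟨g, rfl⟩ := (Ext.mk₀_bijective _ _).2 x
  rw [Ext.mk₀_comp_mk₀] at hx
  exact ⟨g, (Ext.mk₀_bijective _ _).1 hx⟩

lemma e0_mid_right {S : ShortComplex (ModuleCat.{u} A)} (hS : S.ShortExact) {X : ModuleCat.{u} A}
    (h₁ : e0 X S.X₁) (h₃ : e0 X S.X₃) : e0 X S.X₂ := by
  intro e
  obtain ⟨x, rfl⟩ := Ext.covariant_sequence_exact₂ X hS e (h₃ _)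
  rw [h₁ x, Ext.zero_comp]

lemma e0_mid_left {S : ShortComplex (ModuleCat.{u} A)} (hS : S.ShortExact) {Y : ModuleCat.{u} A}
    (h₁ : e0 S.X₁ Y) (h₃ : e0 S.X₃ Y) : e0 S.X₂ Y := by
  intro e
  obtain ⟨x, rfl⟩ := Ext.contravariant_sequence_exact₂ hS Y e (h₁ _)
  rw [h₃ x, Ext.comp_zero]

lemma e0_sub_right {S : ShortComplex (ModuleCat.{u} A)} (hS : S.ShortExact) {X : ModuleCat.{u} A}
    (h₂ : e0 X S.X₂) (h₃ : homZero X S.X₃) : e0 X S.X₁ := by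
  intro e
  obtain ⟨x, rfl⟩ := Ext.covariant_sequence_exact₁ X hS e (h₂ _) (zero_add 1)
  obtain ⟨g, rfl⟩ := (Ext.mk₀_bijective _ _).2 x
  rw [h₃ g, Ext.mk₀_zero, Ext.zero_comp]

lemma e0_quot_left {S : ShortComplex (ModuleCat.{u} A)} (hS : S.ShortExact) {Y : ModuleCat.{u} A}
    (h₂ : e0 S.X₂ Y) (h₁ : homZero S.X₁ Y) : e0 S.X₃ Y := by
  intro e
  obtain ⟨x, rfl⟩ := Ext.contravariant_sequence_exact₃ hS Y e (h₂ _) (add_zero 1)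
  obtain ⟨g, rfl⟩ := (Ext.mk₀_bijective _ _).2 x
  rw [h₁ g, Ext.mk₀_zero, Ext.comp_zero]

lemma shortExact_of_epi {X Y : ModuleCat.{u} A} (p : X ⟶ Y) [Epi p] :
    (ShortComplex.mk (kernel.ι p) p (kernel.condition p)).ShortExact where
  exact := ShortComplex.exact_of_f_is_kernel _ (kernelIsKernel p)
  mono_f := by dsimp; infer_instance
  epi_g := by dsimp; infer_instance

lemma shortExact_of_mono {X Y : ModuleCat.{u} A} (i : X ⟶ Y) [Mono i] :
    (ShortComplex.mk i (cokernel.π i) (cokernel.condition i)).ShortExact where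
  exact := ShortComplex.exact_of_g_is_cokernel _ (cokernelIsCokernel i)
  mono_f := by dsimp; infer_instance
  epi_g := by dsimp; infer_instance

lemma extZero_iff_s7 (X Y : ModuleCat.{u} A) : extZero X Y ↔ e0 X Y := by
  constructor
  · intro h e
    have hS := shortExact_of_epi (Projective.π X)
    obtain ⟨x, rfl⟩ := Ext.contravariant_sequence_exact₃ hS Y e
      (Ext.eq_zero_of_projective _) (add_zero 1)
    obtain ⟨φ, rfl⟩ := (Ext.mk₀_bijective _ _).2 x
    dsimp at φ
    let ι := kernel.ι (Projective.π X)
    let q : pushout ι φ ⟶ X := pushout.desc (Projective.π X) 0 (by simp [ι])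
    have w : pushout.inr ι φ ≫ q = 0 := pushout.inr_desc _ _ _
    have hq : pushout.inl ι φ ≫ q = Projective.π X := pushout.inl_desc _ _ _
    have epiq : Epi q := epi_of_epi_fac hq
    have hT : (ShortComplex.mk (pushout.inr ι φ) q w).ShortExact := by
      refine { exact := ?_, mono_f := by dsimp; infer_instance, epi_g := epiq }
      apply ShortComplex.exact_of_g_is_cokernel
      refine CokernelCofork.IsColimit.ofπ' q w (fun {Z} z hz => ?_)
      have h1 : ι ≫ pushout.inl ι φ ≫ z = 0 := by
        rw [← Category.assoc, pushout.condition, Category.assoc, hz, comp_zero]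
      refine ⟨hS.exact.desc (pushout.inl ι φ ≫ z) h1, ?_⟩
      apply pushout.hom_ext
      · rw [← Category.assoc, hq]
        exact hS.exact.g_desc _ _
      · rw [← Category.assoc, w, hz, zero_comp]
    obtain ⟨s, hs⟩ := h _ _ _ w hT
    let sp := ShortComplex.Splitting.ofExactOfSection _ hT.exact s hs hT.mono_f
    have : φ = ι ≫ (pushout.inl ι φ ≫ sp.r) := by
      have := sp.f_r
      dsimp at this
      rw [← Category.assoc, pushout.condition, Category.assoc, this, Category.comp_id]
    rw [this, ← Ext.mk₀_comp_mk₀]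
    exact hS.extClass_comp_assoc _
  · intro h E i p w hS
    exact lift_of_e0 hS h (𝟙 X)

lemma ext2 (hA : Hereditary A) (X Y : ModuleCat.{u} A) (e : Ext.{u} X Y 2) : e = 0 := by
  have hS := shortExact_of_epi (Projective.π X)
  obtain ⟨x, rfl⟩ := Ext.contravariant_sequence_exact₃ hS Y e
      (Ext.eq_zero_of_projective _) (show 1 + 1 = 2 from rfl)
  have : Projective (kernel (Projective.π X)) := by
    refine Projective.of_iso (ModuleCat.kernelIsoKer (Projective.π X)).symm (hA _ inferInstance _)
  dsimp at x
  rw [Ext.eq_zero_of_projective x, Ext.comp_zero]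

lemma e0_quot_right (hA : Hereditary A) {S : ShortComplex (ModuleCat.{u} A)} (hS : S.ShortExact) {X : ModuleCat.{u} A}
    (h₂ : e0 X S.X₂) : e0 X S.X₃ := by
  intro e
  obtain ⟨x, rfl⟩ := Ext.covariant_sequence_exact₃ X hS e (show 1 + 1 = 2 from rfl) (ext2 hA _ _ _)
  rw [h₂ x, Ext.zero_comp]

lemma e0_sub_left (hA : Hereditary A) {S : ShortComplex (ModuleCat.{u} A)} (hS : S.ShortExact) {Y : ModuleCat.{u} A}
    (h₂ : e0 S.X₂ Y) : e0 S.X₁ Y := by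
  intro e
  obtain ⟨x, rfl⟩ := Ext.contravariant_sequence_exact₁ hS Y e (show 1 + 1 = 2 from rfl) (ext2 hA _ _ _)
  rw [h₂ x, Ext.comp_zero]

lemma hz_mono {T Y Y' : ModuleCat.{u} A} (i : Y ⟶ Y') [Mono i] (h : homZero T Y') :
    homZero T Y := fun f => by
  rw [← cancel_mono i, h (f ≫ i), zero_comp]

lemma hz_epi {T Y Y' : ModuleCat.{u} A} (p : Y ⟶ Y') [Epi p] (h : homZero Y T) :
    homZero Y' T := fun f => by
  rw [← cancel_epi p, h (p ≫ f), comp_zero]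

lemma hz_mid_right {S : ShortComplex (ModuleCat.{u} A)} (hS : S.ShortExact) {X : ModuleCat.{u} A}
    (h₁ : homZero X S.X₁) (h₃ : homZero X S.X₃) : homZero X S.X₂ := by
  intro f
  have := hS.mono_f
  have h := hS.exact.lift_f f (h₃ _)
  rw [← h, h₁ (hS.exact.lift f (h₃ _)), zero_comp]

lemma hz_mid_left {S : ShortComplex (ModuleCat.{u} A)} (hS : S.ShortExact) {X : ModuleCat.{u} A}
    (h₁ : homZero S.X₁ X) (h₃ : homZero S.X₃ X) : homZero S.X₂ X := by
  intro f
  have := hS.epi_g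
  have h := hS.exact.g_desc f (h₁ _)
  rw [← h, h₃ (hS.exact.desc f (h₁ _)), comp_zero]

/-- right perpendicular -/
def RP (T Y : ModuleCat.{u} A) : Prop := homZero T Y ∧ e0 T Y

/-- left perpendicular -/
def LP (T Y : ModuleCat.{u} A) : Prop := homZero Y T ∧ e0 Y T

lemma rperp_iff (T Y : ModuleCat.{u} A) : rperp T Y ↔ RP T Y :=
  and_congr Iff.rfl (extZero_iff_s7 _ _)

lemma lperp_iff (T Y : ModuleCat.{u} A) : lperp T Y ↔ LP T Y :=
  and_congr Iff.rfl (extZero_iff_s7 _ _)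

lemma RP1 {S : ShortComplex (ModuleCat.{u} A)} (hS : S.ShortExact) {T : ModuleCat.{u} A}
    (h₂ : RP T S.X₂) (h₃ : RP T S.X₃) : RP T S.X₁ :=
  ⟨have := hS.mono_f; hz_mono S.f h₂.1, e0_sub_right hS h₂.2 h₃.1⟩

lemma RP2 {S : ShortComplex (ModuleCat.{u} A)} (hS : S.ShortExact) {T : ModuleCat.{u} A}
    (h₁ : RP T S.X₁) (h₃ : RP T S.X₃) : RP T S.X₂ :=
  ⟨hz_mid_right hS h₁.1 h₃.1, e0_mid_right hS h₁.2 h₃.2⟩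

lemma RP3 (hA : Hereditary A) {S : ShortComplex (ModuleCat.{u} A)} (hS : S.ShortExact)
    {T : ModuleCat.{u} A} (h₁ : RP T S.X₁) (h₂ : RP T S.X₂) : RP T S.X₃ :=
  ⟨fun f => by
    obtain ⟨g, rfl⟩ := lift_of_e0 hS h₁.2 f
    rw [h₂.1 g, zero_comp], e0_quot_right hA hS h₂.2⟩

lemma LP1 (hA : Hereditary A) {S : ShortComplex (ModuleCat.{u} A)} (hS : S.ShortExact)
    {T : ModuleCat.{u} A} (h₂ : LP T S.X₂) (h₃ : LP T S.X₃) : LP T S.X₁ :=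
  ⟨fun f => by
    obtain ⟨g, rfl⟩ := extend_of_e0 hS h₃.2 f
    rw [h₂.1 g, comp_zero], e0_sub_left hA hS h₂.2⟩

lemma LP2 {S : ShortComplex (ModuleCat.{u} A)} (hS : S.ShortExact) {T : ModuleCat.{u} A}
    (h₁ : LP T S.X₁) (h₃ : LP T S.X₃) : LP T S.X₂ :=
  ⟨hz_mid_left hS h₁.1 h₃.1, e0_mid_left hS h₁.2 h₃.2⟩

lemma LP3 {S : ShortComplex (ModuleCat.{u} A)} (hS : S.ShortExact) {T : ModuleCat.{u} A}
    (h₁ : LP T S.X₁) (h₂ : LP T S.X₂) : LP T S.X₃ :=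
  ⟨have := hS.epi_g; hz_epi S.g h₂.1, e0_quot_left hS h₂.2 h₁.1⟩

lemma e0_image_right (hA : Hereditary A) {T X Y : ModuleCat.{u} A} (f : X ⟶ Y) (h : e0 T X) :
    e0 T (image f) :=
  e0_quot_right hA (shortExact_of_epi (factorThruImage f)) h

lemma e0_image_left (hA : Hereditary A) {T X Y : ModuleCat.{u} A} (f : X ⟶ Y) (h : e0 Y T) :
    e0 (image f) T :=
  e0_sub_left hA (shortExact_of_mono (Limits.image.ι f)) h

lemma RP_image (hA : Hereditary A) {T X Y : ModuleCat.{u} A} (f : X ⟶ Y) (h : RP T X)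
    (h' : RP T Y) : RP T (image f) :=
  ⟨hz_mono (Limits.image.ι f) h'.1, e0_image_right hA f h.2⟩

lemma LP_image (hA : Hereditary A) {T X Y : ModuleCat.{u} A} (f : X ⟶ Y) (h : LP T X)
    (h' : LP T Y) : LP T (image f) :=
  ⟨hz_epi (factorThruImage f) h.1, e0_image_left hA f h'.2⟩

/-- finitely generated -/
abbrev fg (X : ModuleCat.{u} A) : Prop := Module.Finite A X

/-- length -/
noncomputable abbrev len (X : ModuleCat.{u} A) : ℕ∞ := Module.length A X

lemma len_add {S : ShortComplex (ModuleCat.{u} A)} (hS : S.ShortExact) :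
    len S.X₂ = len S.X₁ + len S.X₃ :=
  Module.length_eq_add_of_exact S.f.hom S.g.hom hS.moduleCat_injective_f
    hS.moduleCat_surjective_g ((ShortComplex.ShortExact.moduleCat_exact_iff_function_exact S).1 hS.exact)

lemma fg3 {S : ShortComplex (ModuleCat.{u} A)} (hS : S.ShortExact) (h : fg S.X₂) : fg S.X₃ :=
  Module.Finite.of_surjective S.g.hom hS.moduleCat_surjective_g

lemma fg1 [IsNoetherianRing A] {S : ShortComplex (ModuleCat.{u} A)} (hS : S.ShortExact)
    (h : fg S.X₂) : fg S.X₁ :=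
  Module.Finite.of_injective S.f.hom hS.moduleCat_injective_f

lemma fg2 {S : ShortComplex (ModuleCat.{u} A)} (hS : S.ShortExact) (h₁ : fg S.X₁)
    (h₃ : fg S.X₃) : fg S.X₂ := by
  have hex := (ShortComplex.ShortExact.moduleCat_exact_iff_function_exact S).1 hS.exact
  constructor
  refine Submodule.fg_of_fg_map_of_fg_inf_ker S.g.hom ?_ ?_
  · rw [Submodule.map_top, LinearMap.range_eq_top.2 hS.moduleCat_surjective_g]
    exact h₃.1
  · rw [top_inf_eq, LinearMap.exact_iff.1 hex, ← Submodule.map_top]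
    exact h₁.1.map _

lemma fg_image {X Y : ModuleCat.{u} A} (f : X ⟶ Y) (h : fg X) : fg (image f) :=
  fg3 (shortExact_of_epi (factorThruImage f)) h

lemma len_ne_top [IsNoetherianRing A] [IsArtinianRing A] {X : ModuleCat.{u} A} (h : fg X) :
    len X ≠ ⊤ := Module.length_ne_top

lemma image_nontrivial {X Y : ModuleCat.{u} A} {f : X ⟶ Y} (h : f ≠ 0) :
    Nontrivial (image f : ModuleCat.{u} A) := by
  by_contra hn
  rw [not_nontrivial_iff_subsingleton] at hn
  apply h
  rw [← Limits.image.fac f, (ModuleCat.isZero_of_subsingleton (image f)).eq_zero_of_tgt (factorThruImage f), zero_comp]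

lemma len_cokernel_lt [IsNoetherianRing A] [IsArtinianRing A] {X Y : ModuleCat.{u} A} {f : X ⟶ Y}
    (h : f ≠ 0) (hY : fg Y) : len (cokernel (Limits.image.ι f)) < len Y := by
  have h1 := len_add (shortExact_of_mono (Limits.image.ι f))
  dsimp at h1
  have h2 : len (image f) ≠ 0 := by
    have := image_nontrivial h
    exact (Module.length_pos (R := A)).ne'
  have h3 := len_ne_top (fg3 (shortExact_of_mono (Limits.image.ι f)) hY)
  dsimp at h3
  rw [h1, add_comm]
  obtain ⟨c, hc⟩ := ENat.ne_top_iff_exists.1 h3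
  rw [← hc]
  exact (ENat.add_one_le_iff (ENat.natCast_ne_top c)).1 (by gcongr; exact Order.one_le_iff_pos.2 (pos_iff_ne_zero.2 h2))

lemma exists_exc [IsNoetherianRing A] [IsArtinianRing A] (Φ : ModuleCat.{u} A → Prop)
    (hΦ : ∀ M, Φ M → fg M ∧ Nontrivial M ∧ e0 M M)
    (him : ∀ (M : ModuleCat.{u} A) (f : M ⟶ M), Φ M → f ≠ 0 → Φ (image f)) (hex : ∃ M, Φ M) :
    ∃ X, Φ X ∧ ExceptionalMod X ∧ ∀ M, Φ M → len X ≤ len M := by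
  obtain ⟨X, hX, hmin⟩ := exists_minimalFor_of_wellFoundedLT Φ (len (A := A)) hex
  have hmin' : ∀ M, Φ M → len X ≤ len M := fun M hM => by
    rcases le_total (len X) (len M) with h | h
    · exact h
    · exact hmin hM h
  obtain ⟨h1, h2, h3⟩ := hΦ X hX
  refine ⟨X, hX, ⟨h1, (extZero_iff_s7 _ _).2 h3, h2, fun f hf => ?_⟩, hmin'⟩
  have hI := hmin' _ (him X f hX hf)
  have hr : LinearMap.range f.hom = ⊤ := by
    by_contra hne
    have h4 := Submodule.length_lt hne
    have h5 : len (image f) = Module.length A (LinearMap.range f.hom) :=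
      (ModuleCat.imageIsoRange f).toLinearEquiv.length_eq
    rw [h5] at hI
    exact absurd h4 (not_lt.2 hI)
  have hs := LinearMap.range_eq_top.1 hr
  have hi := IsNoetherian.injective_of_surjective_endomorphism f.hom hs
  have : Mono f := (ModuleCat.mono_iff_injective f).2 hi
  have : Epi f := (ModuleCat.epi_iff_surjective f).2 hs
  exact isIso_of_mono_of_epi f

lemma finite_hom (K : Type u) [Field K] {A : Type u} [Ring A] [Algebra K A]
    [FiniteDimensional K A] {X Y : ModuleCat.{u} A} (hX : fg X) (hY : fg Y) :
    Module.Finite K (X ⟶ Y) := by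
  let : Module K Y := ModuleCat.moduleOfAlgebraModule Y
  have : IsScalarTower K A Y := ModuleCat.isScalarTower_of_algebra_moduleCat Y
  have : Module.Finite K Y := Module.Finite.trans A Y
  obtain ⟨s, hs⟩ := hX.1
  let ψ : (X ⟶ Y) →ₗ[K] (s → Y) :=
    { toFun := fun f x => f.hom x
      map_add' := fun f g => rfl
      map_smul' := fun c f => rfl }
  refine Module.Finite.of_injective ψ ?_
  intro f g hfg
  apply ModuleCat.hom_ext
  refine LinearMap.ext_on hs ?_
  intro x hx
  exact congrFun hfg ⟨x, hx⟩

lemma finite_ext (K : Type u) [Field K] {A : Type u} [Ring A] [Algebra K A]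
    [FiniteDimensional K A] {X Y : ModuleCat.{u} A} (hX : fg X) (hY : fg Y) :
    Module.Finite K (Ext.{u} X Y 1) := by
  have : IsNoetherianRing A := IsNoetherianRing.of_finite K A
  obtain ⟨n, p, hp⟩ := Module.Finite.exists_fin' A X
  let q : ModuleCat.of A (Fin n → A) ⟶ X := ModuleCat.ofHom p
  have hq : Epi q := (ModuleCat.epi_iff_surjective q).2 hp
  have hS := shortExact_of_epi q
  have hF : fg (ModuleCat.of A (Fin n → A)) := inferInstanceAs (Module.Finite A (Fin n → A))
  have hP : Projective (ModuleCat.of A (Fin n → A)) :=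
    (IsProjective.iff_projective (R := A) (Fin n → A)).1 inferInstance
  have hΩ : fg (kernel q) := fg1 hS hF
  have := finite_hom K hΩ hY
  let ψ : (kernel q ⟶ Y) →ₗ[K] Ext.{u} X Y 1 :=
    (Ext.bilinearCompOfLinear K X (kernel q) Y 1 0 1 rfl hS.extClass).comp
      (Ext.linearEquiv₀ (R := K)).symm.toLinearMap
  refine Module.Finite.of_surjective ψ ?_
  intro e
  obtain ⟨x, hx⟩ := Ext.contravariant_sequence_exact₃ hS Y e
      (Ext.eq_zero_of_projective _) (add_zero 1)
  refine ⟨Ext.linearEquiv₀ (R := K) x, ?_⟩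
  simp only [ψ, LinearMap.comp_apply, LinearEquiv.coe_coe, LinearEquiv.symm_apply_apply]
  exact hx

lemma ext_step (K : Type u) [Field K] {A : Type u} [Ring A] [Algebra K A]
    [FiniteDimensional K A] {T : ModuleCat.{u} A} (hT : fg T) (hTT : e0 T T)
    (Φ : ModuleCat.{u} A → Prop) (hfg : ∀ M, Φ M → fg M)
    (hΦ : ∀ S : ShortComplex (ModuleCat.{u} A), S.ShortExact → S.X₃ = T → Φ S.X₁ → Φ S.X₂)
    (M : ModuleCat.{u} A) (hM : Φ M) : ∃ M', Φ M' ∧ e0 T M' := by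
  generalize hd : Module.finrank K (Ext.{u} T M 1) = d
  induction d using Nat.strong_induction_on generalizing M with
  | _ d ih =>
    subst hd
    by_cases h : extZero T M
    · exact ⟨M, hM, (extZero_iff_s7 _ _).1 h⟩
    · unfold extZero at h
      push Not at h
      obtain ⟨N, i, p, w, hS, hns⟩ := h
      have hN : Φ N := hΦ _ hS rfl hM
      refine ih _ ?_ N hN rfl
      have := finite_ext K hT (hfg _ hM)
      let ψ : Ext.{u} T M 1 →ₗ[K] Ext.{u} T N 1 :=
        (Ext.bilinearCompOfLinear K T M N 1 0 1 rfl).flip (Ext.mk₀ i)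
      have hsurj : Function.Surjective ψ := by
        intro e
        obtain ⟨x, hx⟩ := Ext.covariant_sequence_exact₂ T hS e (hTT _)
        exact ⟨x, hx⟩
      have hker : ψ hS.extClass = 0 := hS.extClass_comp
      have hne : hS.extClass ≠ 0 := by
        intro h0
        obtain ⟨x, hx⟩ := Ext.covariant_sequence_exact₃ T hS (Ext.mk₀ (𝟙 T)) (zero_add 1)
          (by rw [h0, Ext.comp_zero])
        obtain ⟨g, rfl⟩ := (Ext.mk₀_bijective _ _).2 x
        rw [Ext.mk₀_comp_mk₀] at hx
        exact hns g ((Ext.mk₀_bijective _ _).1 hx)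
      have h1 := ψ.finrank_range_add_finrank_ker
      rw [LinearMap.range_eq_top.2 hsurj, finrank_top] at h1
      have h2 : 0 < Module.finrank K (LinearMap.ker ψ) := by
        rw [Module.finrank_pos_iff]
        exact ⟨⟨⟨hS.extClass, hker⟩, 0, fun h => hne (congrArg Subtype.val h)⟩⟩
      omega

lemma hom_step [IsNoetherianRing A] [IsArtinianRing A] (hA : Hereditary A) {T : ModuleCat.{u} A}
    (Φ : ModuleCat.{u} A → Prop) (hfg : ∀ M, Φ M → fg M)
    (hΦ : ∀ (M : ModuleCat.{u} A) (f : T ⟶ M), Φ M → Φ (cokernel (Limits.image.ι f)))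
    (M : ModuleCat.{u} A) (hM : Φ M) (he : e0 T M) : ∃ M', Φ M' ∧ RP T M' := by
  generalize hd : len M = d
  induction d using WellFoundedLT.induction generalizing M with
  | _ d ih =>
    subst hd
    by_cases h : homZero T M
    · exact ⟨M, hM, h, he⟩
    · unfold homZero at h
      push Not at h
      obtain ⟨f, hf⟩ := h
      exact ih _ (len_cokernel_lt hf (hfg _ hM)) _ (hΦ M f hM)
        (e0_quot_right hA (shortExact_of_mono (Limits.image.ι f)) he) rfl

lemma inSupport_of_sub {S M I : ModuleCat.{u} A} [IsSimpleModule A S] (i : I ⟶ M) [Mono i]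
    (h : I ⟶ S) (hh : h ≠ 0) : InSupport S M := by
  have hi := (ModuleCat.mono_iff_injective i).1 inferInstance
  let e := LinearEquiv.ofInjective i.hom hi
  let h' : LinearMap.range i.hom →ₗ[A] S := h.hom ∘ₗ e.symm.toLinearMap
  have hs : Function.Surjective h' := by
    apply LinearMap.surjective_of_ne_zero
    intro h0
    apply hh
    apply ModuleCat.hom_ext
    ext x
    have := LinearMap.congr_fun h0 (e x)
    simpa [h'] using this
  refine ⟨(LinearMap.ker h').map (LinearMap.range i.hom).subtype, LinearMap.range i.hom, ?_, ?_⟩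
  · exact Submodule.map_subtype_le _ _
  · rw [Submodule.comap_map_eq_of_injective (Submodule.injective_subtype _)]
    exact ⟨(h'.quotKerEquivOfSurjective hs).toModuleIso⟩

lemma hom_of_inSupport {S M P : ModuleCat.{u} A} [Projective P] (g : P ⟶ S) (hg : g ≠ 0)
    (h : InSupport S M) : ∃ f : P ⟶ M, f ≠ 0 := by
  obtain ⟨N₁, N₂, -, ⟨e⟩⟩ := h
  let q : ModuleCat.of A N₂ ⟶ ModuleCat.of A (N₂ ⧸ (Submodule.comap N₂.subtype N₁)) :=
    ModuleCat.ofHom (Submodule.mkQ _)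
  have hq : Epi q := (ModuleCat.epi_iff_surjective q).2 (Submodule.mkQ_surjective _)
  let i : ModuleCat.of A N₂ ⟶ M := ModuleCat.ofHom N₂.subtype
  have hi : Mono i := (ModuleCat.mono_iff_injective i).2 (Submodule.injective_subtype _)
  refine ⟨Projective.factorThru g (q ≫ e.hom) ≫ i, fun h0 => hg ?_⟩
  have h1 : Projective.factorThru g (q ≫ e.hom) = 0 := by
    rw [← cancel_mono i, h0, zero_comp]
  rw [← Projective.factorThru_comp g (q ≫ e.hom), h1, zero_comp]

lemma exists_proj [IsNoetherianRing A] [IsArtinianRing A] (hA : Hereditary A)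
    (S : ModuleCat.{u} A) [IsSimpleModule A S] :
    ∃ P : ModuleCat.{u} A, Projective P ∧ fg P ∧
      ∀ M, (∃ f : P ⟶ M, f ≠ 0) ↔ InSupport S M := by
  let Φ : ModuleCat.{u} A → Prop := fun P => Projective P ∧ fg P ∧ ∃ g : P ⟶ S, g ≠ 0
  have hex : ∃ P, Φ P := by
    have : Nontrivial S := IsSimpleModule.nontrivial A S
    obtain ⟨s, hs⟩ := exists_ne (0 : S)
    refine ⟨ModuleCat.of A A, (IsProjective.iff_projective (R := A) A).1 inferInstance,
      inferInstanceAs (Module.Finite A A), ModuleCat.ofHom (LinearMap.toSpanSingleton A S s), ?_⟩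
    intro h0
    apply hs
    have := LinearMap.congr_fun (congrArg ModuleCat.Hom.hom h0) (1 : A)
    simpa using this
  obtain ⟨P, hP, hmin⟩ := exists_minimalFor_of_wellFoundedLT Φ (len (A := A)) hex
  obtain ⟨hPp, hPf, g, hg⟩ := hP
  refine ⟨P, hPp, hPf, fun M => ⟨?_, hom_of_inSupport g hg⟩⟩
  rintro ⟨f, hf⟩
  have hS := shortExact_of_epi (factorThruImage f)
  have hk : kernel.ι (factorThruImage f) ≫ g = 0 := by
    by_contra hne
    have hΦ : Φ (kernel (factorThruImage f)) :=
      ⟨Projective.of_iso (ModuleCat.kernelIsoKer _).symm (hA _ hPp _), fg1 hS hPf, _, hne⟩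
    have h1 := len_add hS
    dsimp at h1
    have h2 : len P ≤ len (kernel (factorThruImage f)) := by
      rcases le_total (len P) (len (kernel (factorThruImage f))) with h | h
      · exact h
      · exact hmin hΦ h
    have h3 : 0 < len (image f) := by
      have := image_nontrivial hf
      exact Module.length_pos (R := A)
    have h4 := len_ne_top hΦ.2.1
    rw [h1] at h2
    obtain ⟨c, hc⟩ := ENat.ne_top_iff_exists.1 h4
    rw [← hc] at h2
    have h5 : (c : ℕ∞) + 1 ≤ c := le_trans (by gcongr; exact Order.one_le_iff_pos.2 h3) h2
    exact absurd ((ENat.add_one_le_iff (ENat.natCast_ne_top c)).1 h5) (lt_irrefl _)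
  have hd := hS.exact.g_desc g hk
  refine inSupport_of_sub (Limits.image.ι f) (hS.exact.desc g hk) ?_
  intro h0
  apply hg
  rw [← hd, h0, comp_zero]

lemma insert_exc {n : ℕ} {E : Fin n → ModuleCat.{u} A} (hE : IsExcSeq E) (k : Fin n)
    {X Y : ModuleCat.{u} A} (hX : ExceptionalMod X) (hY : ExceptionalMod Y)
    (hXY : rperp X Y)
    (aX : ∀ j, k < j → rperp (E j) X) (aY : ∀ j, k < j → rperp (E j) Y)
    (bX : ∀ j, j < k → rperp X (E j)) (bY : ∀ j, j < k → rperp Y (E j)) :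
    ∃ F : Fin (n + 1) → ModuleCat.{u} A, IsExcSeq F := by
  have hG : IsExcSeq (Function.update E k X) := by
    constructor
    · intro i
      by_cases h : i = k
      · subst h; simpa using hX
      · simpa [h] using hE.1 i
    · intro i j hij
      by_cases hi : i = k
      · subst hi
        rw [Function.update_self, Function.update_of_ne hij.ne']
        exact aX j hij
      · by_cases hj : j = k
        · subst hj
          rw [Function.update_self, Function.update_of_ne hij.ne]
          exact bX i hij
        · rw [Function.update_of_ne hi, Function.update_of_ne hj]
          exact hE.2 i j hij
  refine ⟨Fin.insertNth (α := fun _ => ModuleCat.{u} A) k.castSucc Y (Function.update E k X), ?_, ?_⟩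
  · rw [Fin.forall_iff_succAbove k.castSucc]
    refine ⟨by simpa using hY, fun i => by simpa using hG.1 i⟩
  · rw [Fin.forall_iff_succAbove k.castSucc]
    constructor
    · rw [Fin.forall_iff_succAbove k.castSucc]
      refine ⟨fun h => absurd h (lt_irrefl _), fun j hj => ?_⟩
      rw [Fin.lt_succAbove_iff_le_castSucc, Fin.castSucc_le_castSucc_iff] at hj
      simp only [Fin.insertNth_apply_same, Fin.insertNth_apply_succAbove]
      rcases hj.eq_or_lt with h | h
      · subst h; simpa using hXY
      · rw [Function.update_of_ne h.ne']
        exact aY j h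
    · intro i
      rw [Fin.forall_iff_succAbove k.castSucc]
      refine ⟨fun h => ?_, fun j hj => ?_⟩
      · rw [Fin.succAbove_lt_iff_castSucc_lt, Fin.castSucc_lt_castSucc_iff] at h
        simp only [Fin.insertNth_apply_same, Fin.insertNth_apply_succAbove]
        rw [Function.update_of_ne h.ne]
        exact bY i h
      · rw [Fin.succAbove_lt_succAbove_iff] at hj
        simp only [Fin.insertNth_apply_succAbove]
        exact hG.2 i j hj

lemma projIn_of_e0 {n : ℕ} {E : Fin n → ModuleCat.{u} A} (hE : IsExcSeq E) (k : Fin n)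
    (h : ∀ Y, Aperp E k Y → e0 (E k) Y) : RelProj E k := by
  refine ⟨fun j hj => hE.2 k j hj, fun Y Z hY hZ p hp f => ?_⟩
  refine lift_of_e0 (shortExact_of_epi p) (h _ fun j hj => ?_) f
  rw [rperp_iff]
  exact RP1 (shortExact_of_epi p) ((rperp_iff _ _).1 (hY j hj)) ((rperp_iff _ _).1 (hZ j hj))

lemma e0_of_injIn {n : ℕ} {E : Fin n → ModuleCat.{u} A} (k : Fin n)
    (h : RelInj E k) (Z : ModuleCat.{u} A) (hZ : Bperp E k Z) : e0 Z (E k) := by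
  rw [← extZero_iff_s7]
  intro N i p w hS
  have hN : Bperp E k N := fun j hj => by
    rw [lperp_iff]
    exact LP2 hS ((lperp_iff _ _).1 (h.1 j hj)) ((lperp_iff _ _).1 (hZ j hj))
  obtain ⟨r, hr⟩ := h.2 _ _ h.1 hN i hS.mono_f (𝟙 _)
  let sp := ShortComplex.Splitting.ofExactOfRetraction _ hS.exact r hr hS.epi_g
  exact ⟨sp.s, sp.s_g⟩

lemma exists_L (K : Type u) [Field K] {A : Type u} [Ring A] [Algebra K A]
    [FiniteDimensional K A] (hA : Hereditary A)
    {n : ℕ} {E : Fin n → ModuleCat.{u} A} (hE : IsExcSeq E) (k : Fin n)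
    (P : ModuleCat.{u} A) (hP : Projective P) (hPf : fg P)
    (hPj : ∀ j, j < k → homZero P (E j)) (hPk : ∃ f : P ⟶ E k, f ≠ 0) :
    ∃ M : ModuleCat.{u} A, fg M ∧ (∀ j, j < k → LP (E j) M) ∧
      (∀ Y, (∀ j, k < j → RP (E j) Y) → e0 M Y) ∧ (∃ f : M ⟶ E k, f ≠ 0) ∧
      (∀ j, k < j → RP (E j) M) := by
  have : IsNoetherianRing A := IsNoetherianRing.of_finite K A
  have : IsArtinianRing A := IsArtinianRing.of_finite K A
  have hRP : ∀ i j : Fin n, i < j → RP (E j) (E i) := fun i j h => (rperp_iff _ _).1 (hE.2 i j h)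
  have key : ∀ m : ℕ, ∃ M : ModuleCat.{u} A, fg M ∧ (∀ j, j < k → LP (E j) M) ∧
      (∀ Y, (∀ j, k < j → RP (E j) Y) → e0 M Y) ∧ (∃ f : M ⟶ E k, f ≠ 0) ∧
      (∀ j, k < j → n ≤ (j : ℕ) + m → RP (E j) M) := by
    intro m
    induction m with
    | zero =>
      exact ⟨P, hPf, fun j hj => ⟨hPj j hj, fun e => Ext.eq_zero_of_projective e⟩,
        fun Y _ e => Ext.eq_zero_of_projective e, hPk, fun j _ h => by omega⟩
    | succ m ih =>
      obtain ⟨M, hM⟩ := ih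
      by_cases hj : ∃ j : Fin n, k < j ∧ (j : ℕ) + (m + 1) = n
      · obtain ⟨j, hkj, hjm⟩ := hj
        let T := E j
        let Φ : ModuleCat.{u} A → Prop := fun M => fg M ∧ (∀ j, j < k → LP (E j) M) ∧
          (∀ Y, (∀ j, k < j → RP (E j) Y) → e0 M Y) ∧ (∃ f : M ⟶ E k, f ≠ 0) ∧
          (∀ j, k < j → n ≤ (j : ℕ) + m → RP (E j) M)
        have hTfg : fg T := (hE.1 j).1
        have hTT : e0 T T := (extZero_iff_s7 _ _).1 (hE.1 j).2.1
        have hTB : ∀ i, i < k → LP (E i) T := fun i hi => hRP i j (hi.trans hkj)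
        have hTR : ∀ i : Fin n, n ≤ (i : ℕ) + m → RP (E i) T := fun i hi =>
          hRP j i (by rw [Fin.lt_def]; omega)
        obtain ⟨U, hU, hTU⟩ := ext_step K hTfg hTT Φ (fun M h => h.1) (by
          rintro S hS hS3 ⟨h1, h2, h3, ⟨f, hf⟩, h5⟩
          refine ⟨fg2 hS h1 (hS3 ▸ hTfg), fun i hi => LP2 hS (h2 i hi) (hS3 ▸ hTB i hi),
            fun Y hY => e0_mid_left hS (h3 Y hY) (hS3 ▸ (hY j hkj).2), ?_,
            fun i hi hi' => RP2 hS (h5 i hi hi') (hS3 ▸ hTR i hi')⟩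
          obtain ⟨g, hg⟩ := extend_of_e0 hS (hS3 ▸ (hRP k j hkj).2) f
          refine ⟨g, fun h0 => hf ?_⟩
          rw [← hg, h0, comp_zero]) M hM
        obtain ⟨V, hV, hTV⟩ := hom_step hA (T := T) Φ (fun M h => h.1) (by
          rintro N f ⟨h1, h2, h3, ⟨g, hg⟩, h5⟩
          have hS := shortExact_of_mono (Limits.image.ι f)
          refine ⟨fg3 hS h1, fun i hi => LP3 hS (LP_image hA f (hTB i hi) (h2 i hi)) (h2 i hi),
            fun Y hY => e0_quot_left hS (h3 Y hY) (hz_epi (factorThruImage f) (hY j hkj).1), ?_,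
            fun i hi hi' => RP3 hA hS (RP_image hA f (hTR i hi') (h5 i hi hi')) (h5 i hi hi')⟩
          have h0 : Limits.image.ι f ≫ g = 0 :=
            hz_epi (factorThruImage f) (hRP k j hkj).1 _
          refine ⟨cokernel.desc _ g h0, fun hz => hg ?_⟩
          rw [← cokernel.π_desc _ g h0, hz, comp_zero]) U hU hTU
        obtain ⟨h1, h2, h3, h4, h5⟩ := hV
        refine ⟨V, h1, h2, h3, h4, fun i hi hi' => ?_⟩
        by_cases h : n ≤ (i : ℕ) + m
        · exact h5 i hi h
        · have : i = j := Fin.ext (by omega)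
          subst this
          exact hTV
      · obtain ⟨h1, h2, h3, h4, h5⟩ := hM
        refine ⟨M, h1, h2, h3, h4, fun i hi hi' => ?_⟩
        apply h5 i hi
        by_contra h
        exact hj ⟨i, hi, by omega⟩
  obtain ⟨M, h1, h2, h3, h4, h5⟩ := key n
  exact ⟨M, h1, h2, h3, h4, fun j hj => h5 j hj (by omega)⟩

lemma relProj_of_proj (K : Type u) [Field K] {A : Type u} [Ring A] [Algebra K A]
    [FiniteDimensional K A] (hA : Hereditary A)
    {n : ℕ} {E : Fin n → ModuleCat.{u} A} (hE : CompleteES E) (k : Fin n) (hinj : RelInj E k)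
    (P : ModuleCat.{u} A) (hP : Projective P) (hPf : fg P)
    (hPj : ∀ j, j < k → homZero P (E j)) (hPk : ∃ f : P ⟶ E k, f ≠ 0) : RelProj E k := by
  have : IsNoetherianRing A := IsNoetherianRing.of_finite K A
  have : IsArtinianRing A := IsArtinianRing.of_finite K A
  have hRP : ∀ i j : Fin n, i < j → RP (E j) (E i) := fun i j h =>
    (rperp_iff _ _).1 (hE.1.2 i j h)
  obtain ⟨L, l1, l2, l3, ⟨f, hf⟩, l5⟩ := exists_L K hA hE.1 k P hP hPf hPj hPk
  have hLn : Nontrivial L := by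
    by_contra hn
    rw [not_nontrivial_iff_subsingleton] at hn
    exact hf ((ModuleCat.isZero_of_subsingleton L).eq_zero_of_src f)
  let Ap : ModuleCat.{u} A → Prop := fun Y => ∀ j, k < j → RP (E j) Y
  let Bp : ModuleCat.{u} A → Prop := fun Y => ∀ j, j < k → LP (E j) Y
  let Φ : ModuleCat.{u} A → Prop := fun M =>
    fg M ∧ Nontrivial M ∧ Ap M ∧ Bp M ∧ ∀ Y, Ap Y → e0 M Y
  obtain ⟨X, ⟨x1, x2, x3, x4, x5⟩, hXe, hXmin⟩ := exists_exc Φ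
    (fun M h => ⟨h.1, h.2.1, h.2.2.2.2 M h.2.2.1⟩)
    (fun M f ⟨h1, h2, h3, h4, h5⟩ hf => ⟨fg_image f h1, image_nontrivial hf,
      fun j hj => RP_image hA f (h3 j hj) (h3 j hj),
      fun j hj => LP_image hA f (h4 j hj) (h4 j hj),
      fun Y hY => e0_image_left hA f (h5 Y hY)⟩) ⟨L, l1, hLn, l5, l2, l3⟩
  let Ψ : ModuleCat.{u} A → Prop := fun M => fg M ∧ Ap M ∧ Bp M ∧ ∀ Z, Bp Z → e0 Z M
  have hΨ : ∀ M, Ψ M → homZero X M → ¬ Nontrivial M := by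
    intro M hM hXM hn
    obtain ⟨Y, ⟨⟨y1, y2, y3, y4⟩, y5, y6⟩, hYe, -⟩ := exists_exc
      (fun M => Ψ M ∧ homZero X M ∧ Nontrivial M)
      (fun M h => ⟨h.1.1, h.2.2, h.1.2.2.2 M h.1.2.2.1⟩)
      (fun M f ⟨⟨h1, h2, h3, h4⟩, h5, h6⟩ hf => ⟨⟨fg_image f h1,
        fun j hj => RP_image hA f (h2 j hj) (h2 j hj),
        fun j hj => LP_image hA f (h3 j hj) (h3 j hj),
        fun Y hY => e0_image_right hA f (h4 Y hY)⟩, hz_mono (Limits.image.ι f) h5,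
        image_nontrivial hf⟩) ⟨M, hM, hXM, hn⟩
    obtain ⟨F, hF⟩ := insert_exc hE.1 k hXe hYe ((rperp_iff _ _).2 ⟨y5, x5 Y y2⟩)
      (fun j hj => (rperp_iff _ _).2 (x3 j hj)) (fun j hj => (rperp_iff _ _).2 (y2 j hj))
      (fun j hj => (rperp_iff _ _).2 (x4 j hj)) (fun j hj => (rperp_iff _ _).2 (y3 j hj))
    have := hE.2 _ F hF
    omega
  have main : ∀ Q, Ψ Q → ∀ Y, Ap Y → e0 Q Y := by
    intro Q hQ Y hY
    generalize hd : len Q = d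
    induction d using WellFoundedLT.induction generalizing Q with
    | _ d ih =>
      subst hd
      by_cases h : homZero X Q
      · have h0 := hΨ Q hQ h
        rw [not_nontrivial_iff_subsingleton] at h0
        have : Projective Q := (ModuleCat.isZero_of_subsingleton Q).projective
        exact fun e => Ext.eq_zero_of_projective e
      · unfold homZero at h
        push Not at h
        obtain ⟨f, hf⟩ := h
        obtain ⟨q1, q2, q3, q4⟩ := hQ
        have hS := shortExact_of_mono (Limits.image.ι f)
        have hK := shortExact_of_epi (factorThruImage f)
        have iA : Ap (image f) := fun j hj => RP_image hA f (x3 j hj) (q2 j hj)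
        have iB : Bp (image f) := fun j hj => LP_image hA f (x4 j hj) (q3 j hj)
        have hks : Subsingleton (kernel (factorThruImage f) : ModuleCat.{u} A) := by
          by_contra hn
          rw [not_subsingleton_iff_nontrivial] at hn
          have hΦ : Φ (kernel (factorThruImage f)) := ⟨fg1 hK x1, hn,
            fun j hj => RP1 hK (x3 j hj) (iA j hj), fun j hj => LP1 hA hK (x4 j hj) (iB j hj),
            fun Y hY => e0_sub_left hA hK (x5 Y hY)⟩
          have h2 := hXmin _ hΦ
          have h1 := len_add hK
          dsimp at h1
          have h3 : 0 < len (image f) := by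
            have := image_nontrivial hf
            exact Module.length_pos (R := A)
          have h4 := len_ne_top hΦ.1
          rw [h1] at h2
          obtain ⟨c, hc⟩ := ENat.ne_top_iff_exists.1 h4
          rw [← hc] at h2
          have h5 : (c : ℕ∞) + 1 ≤ c := le_trans (by gcongr; exact Order.one_le_iff_pos.2 h3) h2
          exact absurd ((ENat.add_one_le_iff (ENat.natCast_ne_top c)).1 h5) (lt_irrefl _)
        have hei : e0 (image f) Y := e0_quot_left hK (x5 Y hY) fun g =>
          (ModuleCat.isZero_of_subsingleton (kernel (factorThruImage f))).eq_zero_of_src g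
        refine e0_mid_left hS hei (ih _ (len_cokernel_lt hf q1) _ ?_ rfl)
        exact ⟨fg3 hS q1, fun j hj => RP3 hA hS (iA j hj) (q2 j hj),
          fun j hj => LP3 hS (iB j hj) (q3 j hj), fun Z hZ => e0_quot_right hA hS (q4 Z hZ)⟩
  refine projIn_of_e0 hE.1 k fun Y hY => main (E k) ?_ Y fun j hj => (rperp_iff _ _).1 (hY j hj)
  exact ⟨(hE.1.1 k).1, fun j hj => hRP k j hj, fun j hj => hRP j k hj,
    fun Z hZ => e0_of_injIn k hinj Z fun j hj => (lperp_iff _ _).2 (hZ j hj)⟩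

end helpers

/-- If `Eₖ` is relatively injective but not relatively projective in a
complete exceptional sequence, then the support of `Eₖ` is contained in the union of
the supports of `E₁, …, E_{k-1}`: every simple composition factor of `Eₖ` is a
composition factor of some `E_j` with `j < k`. -/
theorem stmt7 {K : Type u} [Field K] {A : Type u} [Ring A] [Algebra K A]
    [FiniteDimensional K A] (hA : Hereditary A)
    {n : ℕ} (E : Fin n → ModuleCat.{u} A) (hE : CompleteES E) (k : Fin n)
    (hinj : RelInj E k) (hproj : ¬ RelProj E k) :
    ∀ S : ModuleCat.{u} A, IsSimpleModule A S → InSupport S (E k) →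
      ∃ j : Fin n, j < k ∧ InSupport S (E j) := by
  intro S hS hSk
  by_contra hne
  push Not at hne
  have : IsNoetherianRing A := IsNoetherianRing.of_finite K A
  have : IsArtinianRing A := IsArtinianRing.of_finite K A
  obtain ⟨P, hP, hPf, hPM⟩ := exists_proj hA S
  refine hproj (relProj_of_proj K hA hE k hinj P hP hPf (fun j hj f => ?_) ((hPM _).2 hSk))
  by_contra hf
  exact hne j hj ((hPM _).1 ⟨f, hf⟩)

end ExcSeq
end
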